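/- For every BCI-term P, (P♯)♭ =_BCI P. -/

import Mathlib

/-!
The linear combinatory logic `BCI` and the linear lambda calculus, with
the translations `(-)♯ : BCI → λ_lin` and `(-)♭ : λ_lin → BCI`
(Appendix A of Hasegawa, "The braided lambda calculus").
-/

namespace BCILin

/-- `BCI`-terms: variables, the constants `B`, `C`, `I`, and application. -/
inductive CT : Type
  | var : ℕ → CT
  | B : CT
  | C : CT
  | I : CT
  | app : CT → CT → CT

infixl:70 " ⬝ " => CT.app

/-- The list of (free) variables of a `BCI`-term. -/
def cfv : CT → List ℕ
  | .var x => [x]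
  | .app P Q => cfv P ++ cfv Q
  | _ => []

/-- A `BCI`-term is linear: every variable occurs at most once. -/
def CWF (P : CT) : Prop := (cfv P).Nodup

/-- `=_BCI`: the smallest congruence on `BCI`-terms satisfying the ten
axioms of Figure 6 (a complete axiomatization of `BCI`). -/
inductive CEq : CT → CT → Prop
  | refl (P : CT) : CEq P P
  | symm {P Q : CT} : CEq P Q → CEq Q P
  | trans {P Q R : CT} : CEq P Q → CEq Q R → CEq P R
  | app {P P' Q Q' : CT} : CEq P P' → CEq Q Q' → CEq (P ⬝ Q) (P' ⬝ Q')
  | axB (L M N : CT) : CEq (.B ⬝ L ⬝ M ⬝ N) (L ⬝ (M ⬝ N))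
  | axC (L M N : CT) : CEq (.C ⬝ L ⬝ M ⬝ N) (L ⬝ N ⬝ M)
  | axI (M : CT) : CEq (.I ⬝ M) M
  | axBI : CEq (.B ⬝ .I) .I
  | axCBI : CEq (.C ⬝ .B ⬝ .I) .I
  | ax6 : CEq (.B ⬝ (.B ⬝ .B) ⬝ .B) (.B ⬝ (.C ⬝ .B ⬝ .B) ⬝ (.B ⬝ .B ⬝ .B))
  | ax7 : CEq (.B ⬝ (.B ⬝ .C) ⬝ (.B ⬝ .B ⬝ .B)) (.B ⬝ (.C ⬝ .B ⬝ .C) ⬝ (.B ⬝ .B ⬝ .B))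
  | ax8 : CEq (.B ⬝ (.B ⬝ .B) ⬝ .C) (.B ⬝ .C ⬝ (.B ⬝ (.B ⬝ .C) ⬝ .B))
  | axR2 : CEq (.B ⬝ .C ⬝ .C) .I
  | axR3 : CEq (.B ⬝ (.B ⬝ .C) ⬝ (.B ⬝ .C ⬝ (.B ⬝ .C))) (.B ⬝ .C ⬝ (.B ⬝ (.B ⬝ .C) ⬝ .C))

/-- Lambda terms (for the linear lambda calculus `λ_lin`). -/
inductive LT : Type
  | var : ℕ → LT
  | lam : ℕ → LT → LT
  | app : LT → LT → LT

/-- The list of free variables of a lambda term. -/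
def lfv : LT → List ℕ
  | .var x => [x]
  | .lam x M => (lfv M).erase x
  | .app M N => lfv M ++ lfv N

/-- `M` is a linear lambda term: every variable occurs exactly once. -/
def LWF : LT → Prop
  | .var _ => True
  | .lam x M => LWF M ∧ (lfv M).count x = 1
  | .app M N => LWF M ∧ LWF N ∧ ∀ x ∈ lfv M, x ∉ lfv N

/-- Substitution `M[x := N]` of lambda terms. -/
def lsubst : LT → ℕ → LT → LT
  | .var y, x, N => if y = x then N else .var y
  | .lam y M, x, N => if y = x then .lam y M else .lam y (lsubst M x N)
  | .app M₁ M₂, x, N => .app (lsubst M₁ x N) (lsubst M₂ x N)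

/-- `=βη` on lambda terms: the smallest congruence containing β and η. -/
inductive LEq : LT → LT → Prop
  | refl (M : LT) : LEq M M
  | symm {M N : LT} : LEq M N → LEq N M
  | trans {M N P : LT} : LEq M N → LEq N P → LEq M P
  | lam (x : ℕ) {M M' : LT} : LEq M M' → LEq (.lam x M) (.lam x M')
  | app {M M' N N' : LT} : LEq M M' → LEq N N' → LEq (.app M N) (.app M' N')
  | beta (x : ℕ) (M N : LT) : LEq (.app (.lam x M) N) (lsubst M x N)
  | eta (x : ℕ) (M : LT) (h : x ∉ lfv M) : LEq (.lam x (.app M (.var x))) M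

/-- `=β` on lambda terms: the smallest congruence containing β. -/
inductive LEqBeta : LT → LT → Prop
  | refl (M : LT) : LEqBeta M M
  | symm {M N : LT} : LEqBeta M N → LEqBeta N M
  | trans {M N P : LT} : LEqBeta M N → LEqBeta N P → LEqBeta M P
  | lam (x : ℕ) {M M' : LT} : LEqBeta M M' → LEqBeta (.lam x M) (.lam x M')
  | app {M M' N N' : LT} : LEqBeta M M' → LEqBeta N N' → LEqBeta (.app M N) (.app M' N')
  | beta (x : ℕ) (M N : LT) : LEqBeta (.app (.lam x M) N) (lsubst M x N)

/-- The translation `(-)♯ : BCI → λ_lin`: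
`B♯ = λxyz.x (y z)`, `C♯ = λxyz.x z y`, `I♯ = λx.x`, homomorphic on
variables and application. -/
def sharp : CT → LT
  | .var x => .var x
  | .B => .lam 1 (.lam 2 (.lam 3 (.app (.var 1) (.app (.var 2) (.var 3)))))
  | .C => .lam 1 (.lam 2 (.lam 3 (.app (.app (.var 1) (.var 3)) (.var 2))))
  | .I => .lam 1 (.var 1)
  | .app P Q => .app (sharp P) (sharp Q)

/-- Bracket abstraction `λ*x.P` (for `x` occurring exactly once in `P`):
`λ*x.x = I`; `λ*x.(P Q) = C (λ*x.P) Q` if `x` is free in `P`, and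
`λ*x.(P Q) = B P (λ*x.Q)` otherwise. -/
def lstar (x : ℕ) : CT → CT
  | .var y => if y = x then .I else .var y
  | .app P Q => if x ∈ cfv P then .C ⬝ lstar x P ⬝ Q else .B ⬝ P ⬝ lstar x Q
  | P => P

/-- The translation `(-)♭ : λ_lin → BCI`:
`x♭ = x`, `(M N)♭ = M♭ N♭`, `(λx.M)♭ = λ*x.M♭`. -/
def flat : LT → CT
  | .var x => .var x
  | .app M N => .app (flat M) (flat N)
  | .lam x M => lstar x (flat M)

/-- Right unit law for composition. -/
theorem CEq.comp_id (M : CT) : CEq (.B ⬝ M ⬝ .I) M :=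
  (CEq.axC .B .I M).symm.trans ((CEq.app .axCBI (.refl M)).trans (.axI M))

/-- Left unit law for composition. -/
theorem CEq.id_comp (M : CT) : CEq (.B ⬝ .I ⬝ M) M :=
  (CEq.app .axBI (.refl M)).trans (.axI M)

/-- Both sides send `x` to `L (M x) N`. -/
theorem CEq.C_comp (L M N : CT) : CEq (.C ⬝ (.B ⬝ L ⬝ M) ⬝ N) (.B ⬝ (.C ⬝ L ⬝ N) ⬝ M) := by
  have left : CEq (.B ⬝ (.B ⬝ .B) ⬝ .C ⬝ L ⬝ N ⬝ M) (.B ⬝ (.C ⬝ L ⬝ N) ⬝ M) :=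
    .app ((CEq.app (.axB _ _ _) (.refl N)).trans (.axB _ _ _)) (.refl M)
  have inner : CEq (.B ⬝ (.B ⬝ .C) ⬝ .B ⬝ L) (.B ⬝ .C ⬝ (.B ⬝ L)) := .axB _ _ _
  have right : CEq (.B ⬝ .C ⬝ (.B ⬝ (.B ⬝ .C) ⬝ .B) ⬝ L ⬝ N ⬝ M) (.C ⬝ (.B ⬝ L ⬝ M) ⬝ N) :=
    (CEq.app (.app ((CEq.axB _ _ _).trans (.app (.refl .C) inner)) (.refl N)) (.refl M)).trans
      ((CEq.axC _ _ _).trans (.app (.axB _ _ _) (.refl N)))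
  exact right.symm.trans
    ((CEq.app (.app (.app CEq.ax8.symm (.refl L)) (.refl N)) (.refl M)).trans left)

/-- Both sides send `x` to `B (M x) I`, respectively `M x`. -/
theorem CEq.C_B_comp_I (M : CT) : CEq (.C ⬝ (.B ⬝ .B ⬝ M) ⬝ .I) M :=
  (CEq.C_comp .B M .I).trans ((CEq.app (.app (.refl .B) .axCBI) (.refl M)).trans (.id_comp M))

/-- The term `λ*x. B x I` equals `I`. -/
theorem CEq.C_BBI_I : CEq (.C ⬝ (.B ⬝ .B ⬝ .I) ⬝ .I) .I := .C_B_comp_I .I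

theorem flat_sharp_B : CEq (flat (sharp .B)) .B := by
  change CEq (.C ⬝ (.B ⬝ .B ⬝ (.B ⬝ .B ⬝ .I)) ⬝ (.C ⬝ (.B ⬝ .B ⬝ .I) ⬝ .I)) .B
  exact (CEq.app (.refl _) .C_BBI_I).trans ((CEq.C_B_comp_I _).trans (.comp_id .B))

theorem flat_sharp_C : CEq (flat (sharp .C)) .C := by
  change CEq (.C ⬝ (.B ⬝ .B ⬝ (.B ⬝ .C ⬝ (.C ⬝ (.B ⬝ .B ⬝ .I) ⬝ .I))) ⬝ .I) .C
  exact (CEq.C_B_comp_I _).trans ((CEq.app (.refl _) .C_BBI_I).trans (.comp_id .C))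

end BCILin

open BCILin in
/-- For every (linear) `BCI`-term `P`, `(P♯)♭ =_BCI P`. -/
theorem flat_sharp (P : CT) (hP : CWF P) : CEq (flat (sharp P)) P := by
  clear hP
  induction P with
  | var x => exact .refl _
  | B => exact flat_sharp_B
  | C => exact flat_sharp_C
  | I => exact .refl _
  | app P Q ihP ihQ => exact .app ihP ihQ
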